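/- Splitting a disjunction with an assignment: for any assignment A = (x := α..β) and any HT_C formula γ, the formula γ ∨ A has the same HT_C models as (def(A) → Φ(A) ∨ γ) ∧ (¬Φ(A) → γ). -/

import Mathlib

/- Formalization of the fragment of HT_C built from linear constraints over
   conditional linear terms, as used for LC-programs.  The domain `D` contains
   the integers (witnessed by an `IntDom` structure); besides linear constraints,
   formulas may contain abstract condition-free constraint atoms drawn from `A`
   (with an abstract monotonic denotation `den`). -/

universe u v

namespace HTC

/-- Valuations: partial functions from variables `X` to domain values `D`
    (`none` represents the undefined value `u`). -/
def Val (X D : Type) : Type := X → Option D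

/-- `v ⊆ v'` : every variable defined in `v` has the same value in `v'`. -/
def Val.le {X D : Type} (v v' : Val X D) : Prop :=
  ∀ (x : X) (d : D), v x = some d → v' x = some d

/-- Formulas over an abstract type of atoms `A`. -/
inductive Fml (A : Type u) : Type u where
  | bot  : Fml A
  | atom : A → Fml A
  | and  : Fml A → Fml A → Fml A
  | or   : Fml A → Fml A → Fml A
  | imp  : Fml A → Fml A → Fml A

/-- Negation `¬φ := φ → ⊥`. -/
def Fml.neg {A : Type u} (φ : Fml A) : Fml A := φ.imp .bot

/-- Truth `⊤ := ⊥ → ⊥`. -/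
def Fml.top {A : Type u} : Fml A := Fml.neg .bot

/-- Denotation condition (1): monotonicity of the abstract condition-free atoms. -/
def Mono {X D A : Type} (den : A → Set (Val X D)) : Prop :=
  ∀ (a : A) (v v' : Val X D), v ∈ den a → Val.le v v' → v' ∈ den a

/-- Witness that the domain `D` contains the integers (`𝒟 ⊇ ℤ`). -/
structure IntDom (D : Type) : Type where
  emb : ℤ → D
  toInt : D → Option ℤ
  emb_toInt : ∀ n : ℤ, toInt (emb n) = some n
  toInt_emb : ∀ (d : D) (n : ℤ), toInt d = some n → d = emb n

/-- Condition-free linear terms: built from integer constants and variables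
    using `+` and `-`. -/
inductive LTerm (X : Type) : Type where
  | const : ℤ → LTerm X
  | var : X → LTerm X
  | add : LTerm X → LTerm X → LTerm X
  | sub : LTerm X → LTerm X → LTerm X

/-- Linear terms possibly mentioning the undefined value `u`: the result of
    evaluating the conditional expressions of a conditional linear term. -/
inductive UTerm (X : Type) : Type where
  | const : ℤ → UTerm X
  | var : X → UTerm X
  | undef : UTerm X
  | add : UTerm X → UTerm X → UTerm X
  | sub : UTerm X → UTerm X → UTerm X

/-- Embedding of condition-free linear terms. -/
def LTerm.toU {X : Type} : LTerm X → UTerm X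
  | .const n => .const n
  | .var x => .var x
  | .add a b => .add a.toU b.toU
  | .sub a b => .sub a.toU b.toU

/-- Evaluation of a term by a valuation `v`: an integer when all variables of the
    term take integer values (and no `u` occurs), undefined (`none`) otherwise. -/
def UTerm.eval {X D : Type} (I : IntDom D) (v : Val X D) : UTerm X → Option ℤ
  | .const n => some n
  | .var x => (v x).bind I.toInt
  | .undef => none
  | .add a b => (a.eval I v).bind (fun m => (b.eval I v).map (fun n => m + n))
  | .sub a b => (a.eval I v).bind (fun m => (b.eval I v).map (fun n => m - n))

/-- Evaluation of a condition-free linear term. -/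
def LTerm.eval {X D : Type} (I : IntDom D) (v : Val X D) (a : LTerm X) : Option ℤ :=
  a.toU.eval I v

/-- Condition-free atoms: abstract constraint atoms from `A`, or linear
    constraints `α ≤ β` between condition-free linear terms. -/
abbrev CFAtom (X A : Type) : Type := A ⊕ (LTerm X × LTerm X)

/-- Condition-free formulas. -/
abbrev CFml (X A : Type) : Type := Fml (CFAtom X A)

/-- Satisfaction of a condition-free atom by a valuation; a linear constraint
    `α ≤ β` holds iff both terms evaluate to integers `m ≤ n`. -/
def CFAtomSat {X D A : Type} (I : IntDom D) (den : A → Set (Val X D)) (v : Val X D) :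
    CFAtom X A → Prop
  | .inl a => v ∈ den a
  | .inr p => ∃ m n : ℤ, p.1.eval I v = some m ∧ p.2.eval I v = some n ∧ m ≤ n

/-- HT satisfaction of condition-free formulas. -/
def SatCF {X D A : Type} (I : IntDom D) (den : A → Set (Val X D)) :
    Val X D → Val X D → CFml X A → Prop
  | _, _, .bot => False
  | h, _, .atom a => CFAtomSat I den h a
  | h, t, .and φ ψ => SatCF I den h t φ ∧ SatCF I den h t ψ
  | h, t, .or φ ψ => SatCF I den h t φ ∨ SatCF I den h t ψ
  | h, t, .imp φ ψ =>
      (SatCF I den h t φ → SatCF I den h t ψ) ∧ (SatCF I den t t φ → SatCF I den t t ψ)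

/-- Conditional linear terms: linear terms whose subterms may be conditional
    expressions `(s | s' : φ)` with `s`, `s'` condition-free linear terms and `φ`
    a condition-free formula. -/
inductive CLTerm (X A : Type) : Type where
  | const : ℤ → CLTerm X A
  | var : X → CLTerm X A
  | add : CLTerm X A → CLTerm X A → CLTerm X A
  | sub : CLTerm X A → CLTerm X A → CLTerm X A
  | cond : LTerm X → LTerm X → CFml X A → CLTerm X A

open Classical in
/-- `eval⟨h,t⟩(τ)`: replace each conditional expression `(s | s' : φ)` of `τ` by
    `s` if `⟨h,t⟩ ⊨ φ`, by `s'` if `⟨t,t⟩ ⊭ φ`, and by `u` otherwise. -/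
noncomputable def CLTerm.reduce {X D A : Type} (I : IntDom D) (den : A → Set (Val X D))
    (h t : Val X D) : CLTerm X A → UTerm X
  | .const n => .const n
  | .var x => .var x
  | .add a b => .add (a.reduce I den h t) (b.reduce I den h t)
  | .sub a b => .sub (a.reduce I den h t) (b.reduce I den h t)
  | .cond s s' φ =>
      if SatCF I den h t φ then s.toU
      else if ¬ SatCF I den t t φ then s'.toU
      else .undef

/-- Atoms of the LC fragment: abstract condition-free atoms, or linear constraints
    `α ≤ β` between conditional linear terms. -/
abbrev LAtom (X A : Type) : Type := A ⊕ (CLTerm X A × CLTerm X A)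

/-- Formulas of the LC fragment. -/
abbrev LFml (X A : Type) : Type := Fml (LAtom X A)

/-- `⟨h,t⟩ ⊨ c` for an atom of the LC fragment: for a (conditional) linear
    constraint `α ≤ β` this is `h ∈ ⟦eval⟨h,t⟩(α) ≤ eval⟨h,t⟩(β)⟧`. -/
def LAtomSat {X D A : Type} (I : IntDom D) (den : A → Set (Val X D))
    (h t : Val X D) : LAtom X A → Prop
  | .inl a => h ∈ den a
  | .inr p => ∃ m n : ℤ,
      (p.1.reduce I den h t).eval I h = some m ∧
      (p.2.reduce I den h t).eval I h = some n ∧ m ≤ n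

/-- HT_C satisfaction for the LC fragment. -/
def SatL {X D A : Type} (I : IntDom D) (den : A → Set (Val X D)) :
    Val X D → Val X D → LFml X A → Prop
  | _, _, .bot => False
  | h, t, .atom a => LAtomSat I den h t a
  | h, t, .and φ ψ => SatL I den h t φ ∧ SatL I den h t ψ
  | h, t, .or φ ψ => SatL I den h t φ ∨ SatL I den h t ψ
  | h, t, .imp φ ψ =>
      (SatL I den h t φ → SatL I den h t ψ) ∧ (SatL I den t t φ → SatL I den t t ψ)

/-- The linear constraint `α ≤ β` as a formula. -/
def leF {X A : Type} (α β : CLTerm X A) : LFml X A := Fml.atom (Sum.inr (α, β))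

/-- `def(α)`: satisfied in `⟨h,t⟩` iff `h(eval⟨h,t⟩(α)) ∈ ℤ` (encoded as `α ≤ α`). -/
def defF {X A : Type} (α : CLTerm X A) : LFml X A := leF α α

/-- An assignment `x := α..β`. -/
structure Assign (X A : Type) : Type where
  x : X
  lo : CLTerm X A
  hi : CLTerm X A

/-- `def(A) := def(α) ∧ def(β)` for an assignment `A = (x := α..β)`. -/
def Assign.defF {X A : Type} (a : Assign X A) : LFml X A :=
  (HTC.defF a.lo).and (HTC.defF a.hi)

/-- The non-directional version `Φ(A) := (α ≤ x) ∧ (x ≤ β)`. -/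
def Assign.phi {X A : Type} (a : Assign X A) : LFml X A :=
  (leF a.lo (CLTerm.var a.x)).and (leF (CLTerm.var a.x) a.hi)

/-- The assignment `A = (x := α..β)` stands for the formula
    `¬¬def(A) ∧ (def(A) → (α ≤ x) ∧ (x ≤ β))`. -/
def Assign.fml {X A : Type} (a : Assign X A) : LFml X A :=
  (Fml.neg (Fml.neg a.defF)).and (a.defF.imp a.phi)

end HTC

namespace HTC

theorem UTerm.eval_mono {X D : Type} (I : IntDom D) {h t : Val X D} (hle : Val.le h t)
    (s : UTerm X) : ∀ m : ℤ, s.eval I h = some m → s.eval I t = some m := by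
  induction s with
  | const n => intro m hm; exact hm
  | undef => intro m hm; exact hm
  | var x =>
    intro m hm
    simp only [UTerm.eval, Option.bind_eq_some_iff] at hm ⊢
    obtain ⟨d, hd, hm⟩ := hm
    exact ⟨d, hle x d hd, hm⟩
  | add a b iha ihb =>
    intro m hm
    simp only [UTerm.eval, Option.bind_eq_some_iff, Option.map_eq_some_iff] at hm ⊢
    obtain ⟨p, hp, q, hq, e⟩ := hm
    exact ⟨p, iha p hp, q, ihb q hq, e⟩
  | sub a b iha ihb =>
    intro m hm
    simp only [UTerm.eval, Option.bind_eq_some_iff, Option.map_eq_some_iff] at hm ⊢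
    obtain ⟨p, hp, q, hq, e⟩ := hm
    exact ⟨p, iha p hp, q, ihb q hq, e⟩

theorem SatCF_persist {X D A : Type} (I : IntDom D) {den : A → Set (Val X D)}
    (h1 : Mono den) {h t : Val X D} (hle : Val.le h t) (φ : CFml X A) :
    SatCF I den h t φ → SatCF I den t t φ := by
  induction φ with
  | bot => exact id
  | atom a =>
    cases a with
    | inl a => exact fun hh => h1 a h t hh hle
    | inr p =>
      rintro ⟨m, n, hm, hn, hmn⟩
      exact ⟨m, n, UTerm.eval_mono I hle _ m hm, UTerm.eval_mono I hle _ n hn, hmn⟩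
  | and φ ψ ih1 ih2 => exact fun hh => ⟨ih1 hh.1, ih2 hh.2⟩
  | or φ ψ ih1 ih2 => exact fun hh => hh.imp ih1 ih2
  | imp φ ψ ih1 ih2 => exact fun hh => ⟨hh.2, hh.2⟩

theorem CLTerm.eval_mono {X D A : Type} (I : IntDom D) {den : A → Set (Val X D)}
    (h1 : Mono den) {h t : Val X D} (hle : Val.le h t) (s : CLTerm X A) :
    ∀ m : ℤ, (s.reduce I den h t).eval I h = some m →
      (s.reduce I den t t).eval I t = some m := by
  induction s with
  | const n => intro m hm; exact hm
  | var x => intro m hm; exact UTerm.eval_mono I hle (.var x) m hm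
  | add a b iha ihb =>
    intro m hm
    simp only [CLTerm.reduce, UTerm.eval, Option.bind_eq_some_iff,
      Option.map_eq_some_iff] at hm ⊢
    obtain ⟨p, hp, q, hq, e⟩ := hm
    exact ⟨p, iha p hp, q, ihb q hq, e⟩
  | sub a b iha ihb =>
    intro m hm
    simp only [CLTerm.reduce, UTerm.eval, Option.bind_eq_some_iff,
      Option.map_eq_some_iff] at hm ⊢
    obtain ⟨p, hp, q, hq, e⟩ := hm
    exact ⟨p, iha p hp, q, ihb q hq, e⟩
  | cond s s' φ =>
    intro m hm
    by_cases c : SatCF I den h t φ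
    · have c' := SatCF_persist I h1 hle φ c
      simp only [CLTerm.reduce, if_pos c] at hm
      simp only [CLTerm.reduce, if_pos c']
      exact UTerm.eval_mono I hle _ m hm
    · by_cases c' : SatCF I den t t φ
      · simp [CLTerm.reduce, c, c', UTerm.eval] at hm
      · simp only [CLTerm.reduce, if_neg c, if_pos c'] at hm
        simp only [CLTerm.reduce, if_neg c', if_pos c']
        exact UTerm.eval_mono I hle _ m hm

theorem SatL_persist {X D A : Type} (I : IntDom D) {den : A → Set (Val X D)}
    (h1 : Mono den) {h t : Val X D} (hle : Val.le h t) (φ : LFml X A) :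
    SatL I den h t φ → SatL I den t t φ := by
  induction φ with
  | bot => exact id
  | atom a =>
    cases a with
    | inl a => exact fun hh => h1 a h t hh hle
    | inr p =>
      rintro ⟨m, n, hm, hn, hmn⟩
      exact ⟨m, n, CLTerm.eval_mono I h1 hle _ m hm, CLTerm.eval_mono I h1 hle _ n hn, hmn⟩
  | and φ ψ ih1 ih2 => exact fun hh => ⟨ih1 hh.1, ih2 hh.2⟩
  | or φ ψ ih1 ih2 => exact fun hh => hh.imp ih1 ih2
  | imp φ ψ ih1 ih2 => exact fun hh => ⟨hh.2, hh.2⟩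

theorem phi_def {X D A : Type} (I : IntDom D) (den : A → Set (Val X D))
    (h t : Val X D) (a : Assign X A) :
    SatL I den h t a.phi → SatL I den h t a.defF := by
  rintro ⟨⟨m, n, hm, hn, _⟩, ⟨p, q, hp, hq, _⟩⟩
  exact ⟨⟨m, m, hm, hm, le_refl _⟩, ⟨q, q, hq, hq, le_refl _⟩⟩

/-- Lemma 3: splitting a disjunction with an assignment: for any
    assignment `A = (x := α..β)` and any HT_C formula `γ`, the formula `γ ∨ A`
    has the same HT_C models as `(def(A) → Φ(A) ∨ γ) ∧ (¬Φ(A) → γ)`. -/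
theorem assignment_split {X D A : Type} (I : IntDom D)
    (den : A → Set (Val X D)) (h1 : Mono den) (a : Assign X A) (γ : LFml X A) :
    ∀ (h t : Val X D), Val.le h t →
      (SatL I den h t (γ.or a.fml) ↔
       SatL I den h t ((a.defF.imp (a.phi.or γ)).and ((Fml.neg a.phi).imp γ))) := by
  intro h t hle
  have g := SatL_persist I h1 hle γ
  have p := SatL_persist I h1 hle a.phi
  have d := SatL_persist I h1 hle a.defF
  have e1 := phi_def I den h t a
  have e2 := phi_def I den t t a
  simp only [Assign.fml, Fml.neg, SatL]
  generalize SatL I den h t γ = Gh at *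
  generalize SatL I den t t γ = Gt at *
  generalize SatL I den h t a.phi = Ph at *
  generalize SatL I den t t a.phi = Pt at *
  generalize SatL I den h t a.defF = Dh at *
  generalize SatL I den t t a.defF = Dt at *
  clear h1
  by_cases Gh <;> by_cases Gt <;> by_cases Ph <;> by_cases Pt <;> by_cases Dh <;>
    by_cases Dt <;> simp_all

end HTC
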